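/- First-quadrant generating function: for all real z, w with 0 < z < 1 and 0 < w < 1, the (absolutely convergent) double series satisfies ∑_{x≥0} ∑_{y≥0} g(x,y)·z^x·w^y = [ √2·(1 − w/z)/√(1−w²) + (2 − z/w − 1/(z·w))/√(1−z²) ] / ( 4 − w/z − z/w − z·w − 1/(z·w) ). (The denominator equals 4 − (z+1/z)(w+1/w) and is nonzero for such z, w.) -/

import Mathlib

/-- `g` is a slit-plane Green's function: the voltage `G_H` on the half-plane square
lattice `{(x,y) : y ≥ 0, x+y even}` with Dirichlet boundary on the negative `x`-axis,
reflecting boundary on the positive `x`-axis, and one unit of current inserted at the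
origin. -/
def IsSlitGreen (g : ℤ × ℤ → ℝ) : Prop :=
  -- g vanishes off the half-plane lattice
  (∀ x y : ℤ, (y < 0 ∨ Odd (x + y)) → g (x, y) = 0) ∧
  -- (i) Dirichlet boundary on the negative x-axis
  (∀ x : ℤ, x < 0 → g (x, 0) = 0) ∧
  -- (ii) harmonicity off the x-axis
  (∀ x y : ℤ, 1 ≤ y → Even (x + y) →
    4 * g (x, y) =
      g (x - 1, y - 1) + g (x + 1, y - 1) + g (x - 1, y + 1) + g (x + 1, y + 1)) ∧
  -- (iii) reflecting boundary on the positive x-axis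
  (∀ x : ℤ, 0 < x → Even x → 2 * g (x, 0) = g (x - 1, 1) + g (x + 1, 1)) ∧
  -- (iv) one unit of current inserted at the origin
  (2 * g (0, 0) - g (1, 1) - g (-1, 1) = 1) ∧
  -- (v) values between 0 and 1
  (∀ x y : ℤ, 0 ≤ g (x, y) ∧ g (x, y) ≤ 1) ∧
  -- (vi) decay at infinity
  (∀ ε : ℝ, 0 < ε → ∃ N : ℕ, ∀ x y : ℤ, (N : ℤ) ≤ |x| + |y| → |g (x, y)| < ε)

open Complex in
/-- The unit complex number `e^{iθ}` in terms of `t = tan (π/4 - θ/2)`. -/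
noncomputable def slitPhase (t : ℝ) : ℂ := (t + I) / (1 + I * t)

open Complex in
/-- The `x`-dependent factor in the integral representation of the slit-plane Green's function. -/
noncomputable def slitKernel (x : ℤ) (t : ℝ) : ℂ := slitPhase t ^ x / (1 + I * t)

theorem one_add_I_mul_ofReal_ne_zero (t : ℝ) : 1 + Complex.I * (t : ℂ) ≠ 0 := by
  intro h
  simpa using congrArg Complex.re h

theorem ofReal_add_I_ne_zero (t : ℝ) : (t : ℂ) + Complex.I ≠ 0 := by
  intro h
  simpa using congrArg Complex.im h

theorem one_add_ofReal_sq_ne_zero (t : ℝ) : (1 : ℂ) + (t : ℂ) ^ 2 ≠ 0 := by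
  have h : (1 : ℝ) + t ^ 2 ≠ 0 := by positivity
  exact_mod_cast h

theorem slitPhase_ne_zero (t : ℝ) : slitPhase t ≠ 0 :=
  div_ne_zero (ofReal_add_I_ne_zero t) (one_add_I_mul_ofReal_ne_zero t)

theorem norm_slitPhase (t : ℝ) : ‖slitPhase t‖ = 1 := by
  have h : Complex.normSq ((t : ℂ) + Complex.I) = Complex.normSq (1 + Complex.I * t) := by
    simp [Complex.normSq_apply]; ring
  have h' : ‖(t : ℂ) + Complex.I‖ = ‖1 + Complex.I * (t : ℂ)‖ := by
    rw [Complex.norm_def, Complex.norm_def, h]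
  rw [slitPhase, norm_div, h', div_self]
  exact norm_ne_zero_iff.mpr (one_add_I_mul_ofReal_ne_zero t)

theorem norm_slitKernel_le (x : ℤ) (t : ℝ) : ‖slitKernel x t‖ ≤ 1 := by
  rw [slitKernel, norm_div, norm_zpow, norm_slitPhase, one_zpow]
  refine div_le_one_of_le₀ ?_ (norm_nonneg _)
  have h := Complex.abs_re_le_norm (1 + Complex.I * (t : ℂ))
  simpa using h

theorem slitKernel_add_one (x : ℤ) (t : ℝ) :
    slitKernel (x + 1) t = slitPhase t * slitKernel x t := by
  rw [slitKernel, slitKernel, zpow_add_one₀ (slitPhase_ne_zero t)]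
  ring

theorem slitKernel_sub_one (x : ℤ) (t : ℝ) :
    slitKernel (x - 1) t = (slitPhase t)⁻¹ * slitKernel x t := by
  rw [slitKernel, slitKernel, zpow_sub_one₀ (slitPhase_ne_zero t)]
  ring

theorem slitPhase_eq (t : ℝ) :
    slitPhase t = (2 * t + Complex.I * (1 - t ^ 2)) / (1 + t ^ 2) := by
  have h1 := one_add_I_mul_ofReal_ne_zero t
  have h2 := one_add_ofReal_sq_ne_zero t
  rw [slitPhase, div_eq_div_iff h1 h2]
  linear_combination (-t * (1 - t ^ 2) : ℂ) * Complex.I_sq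

theorem slitPhase_inv_eq (t : ℝ) :
    (slitPhase t)⁻¹ = (2 * t - Complex.I * (1 - t ^ 2)) / (1 + t ^ 2) := by
  have h1 := ofReal_add_I_ne_zero t
  have h2 := one_add_ofReal_sq_ne_zero t
  rw [slitPhase, inv_div, div_eq_div_iff h1 h2]
  linear_combination ((1 - t ^ 2) : ℂ) * Complex.I_sq

theorem slitKernel_add_neighbors (x : ℤ) (t : ℝ) :
    (1 + (t : ℂ) ^ 2) * (slitKernel (x + 1) t + slitKernel (x - 1) t) =
      4 * t * slitKernel x t := by
  rw [slitKernel_add_one, slitKernel_sub_one, slitPhase_inv_eq, slitPhase_eq]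
  field_simp [one_add_ofReal_sq_ne_zero t]
  ring

theorem slitKernel_sub_neighbors (x : ℤ) (t : ℝ) :
    slitKernel (x + 1) t - slitKernel (x - 1) t =
      Complex.I * (2 * slitKernel x t - t * (slitKernel (x + 1) t + slitKernel (x - 1) t)) := by
  rw [slitKernel_add_one, slitKernel_sub_one, slitPhase_inv_eq, slitPhase_eq]
  field_simp [one_add_ofReal_sq_ne_zero t]
  ring

theorem slitPhase_hasDerivAt (t : ℝ) :
    HasDerivAt slitPhase (2 / (1 + Complex.I * t) ^ 2) t := by
  have h0 : HasDerivAt (fun s : ℝ => (s : ℂ)) 1 t := Complex.ofRealCLM.hasDerivAt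
  have h1 : HasDerivAt (fun s : ℝ => (s : ℂ) + Complex.I) 1 t := h0.add_const _
  have h2 : HasDerivAt (fun s : ℝ => 1 + Complex.I * (s : ℂ)) (Complex.I * 1) t :=
    (h0.const_mul _).const_add _
  convert! h1.div h2 (one_add_I_mul_ofReal_ne_zero t) using 1
  congr 1
  linear_combination Complex.I_sq

theorem slitKernel_hasDerivAt (x : ℤ) (t : ℝ) :
    HasDerivAt (slitKernel x)
      (-Complex.I * (2 * x / (1 + (t : ℂ) ^ 2) + 1 / (1 + Complex.I * t)) * slitKernel x t) t := by
  have h0 : HasDerivAt (fun s : ℝ => (s : ℂ)) 1 t := Complex.ofRealCLM.hasDerivAt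
  have h2 : HasDerivAt (fun s : ℝ => 1 + Complex.I * (s : ℂ)) (Complex.I * 1) t :=
    (h0.const_mul _).const_add _
  have hz := (hasDerivAt_zpow x (slitPhase t) (Or.inl (slitPhase_ne_zero t))).comp t
    (slitPhase_hasDerivAt t)
  have h1 := one_add_I_mul_ofReal_ne_zero t
  have h3 := one_add_ofReal_sq_ne_zero t
  have h4 := ofReal_add_I_ne_zero t
  convert! hz.div h2 h1 using 1
  simp only [Function.comp, slitKernel]
  rw [zpow_sub_one₀ (slitPhase_ne_zero t)]
  have h5 : (slitPhase t)⁻¹ = (1 + Complex.I * t) / (t + Complex.I) := by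
    rw [slitPhase, inv_div]
  rw [h5]
  have h6 : (1 + (t : ℂ) ^ 2) = -Complex.I * ((1 + Complex.I * t) * (t + Complex.I)) := by
    linear_combination (1 + t * Complex.I + t^2 : ℂ) * Complex.I_sq
  rw [h6]
  field_simp
  ring

theorem slitKernel_boundary_hasDerivAt (x : ℤ) (s : ℝ) :
    HasDerivAt (fun τ : ℝ => (Real.sin τ : ℂ) * slitKernel x (Real.cos τ))
      ((x + 1) * slitKernel (x + 1) (Real.cos s) - x * slitKernel (x - 1) (Real.cos s)) s := by
  have h1 : HasDerivAt (fun τ : ℝ => (Real.sin τ : ℂ)) (Real.cos s : ℂ) s :=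
    (Real.hasDerivAt_sin s).ofReal_comp
  have h2 := (slitKernel_hasDerivAt x (Real.cos s)).scomp s (Real.hasDerivAt_cos s)
  convert! h1.mul h2 using 1
  simp only [Function.comp, Complex.real_smul]
  set t := Real.cos s
  have hs : (Real.sin s : ℂ) * (Real.sin s : ℂ) = 1 - (t : ℂ) ^ 2 := by
    have : Real.sin s * Real.sin s = 1 - t ^ 2 := by
      have := Real.sin_sq_add_cos_sq s
      simp only [t]; linarith
    exact_mod_cast this
  have h3 : (1 : ℂ) / (1 + Complex.I * t) = (1 - Complex.I * t) / (1 + (t : ℂ) ^ 2) := by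
    rw [div_eq_div_iff (one_add_I_mul_ofReal_ne_zero t) (one_add_ofReal_sq_ne_zero t)]
    linear_combination (t ^ 2 : ℂ) * Complex.I_sq
  rw [slitKernel_add_one, slitKernel_sub_one, slitPhase_inv_eq, slitPhase_eq, h3]
  have h4 := one_add_ofReal_sq_ne_zero t
  rw [Complex.ofReal_neg]
  generalize slitKernel x t = K
  field_simp
  linear_combination (-K * Complex.I * (2 * x + 1 - Complex.I * t)) * hs +
    K * t * (1 - t ^ 2) * Complex.I_sq

theorem continuous_slitKernel (x : ℤ) : Continuous (slitKernel x) :=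
  continuous_iff_continuousAt.mpr fun t => (slitKernel_hasDerivAt x t).continuousAt

/-- The integral whose real part is, up to a constant, the slit-plane Green's function. -/
noncomputable def slitIntegral (x : ℤ) (y : ℕ) : ℂ :=
  ∫ τ in (0 : ℝ)..Real.pi, (Real.cos τ : ℂ) ^ y * slitKernel x (Real.cos τ)

theorem continuous_slitIntegrand (x : ℤ) (y : ℕ) :
    Continuous fun τ : ℝ => (Real.cos τ : ℂ) ^ y * slitKernel x (Real.cos τ) :=
  ((Complex.continuous_ofReal.comp Real.continuous_cos).pow y).mul
    ((continuous_slitKernel x).comp Real.continuous_cos)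

theorem intervalIntegrable_slitIntegrand (x : ℤ) (y : ℕ) (a b : ℝ) :
    IntervalIntegrable (fun τ : ℝ => (Real.cos τ : ℂ) ^ y * slitKernel x (Real.cos τ))
      MeasureTheory.volume a b :=
  (continuous_slitIntegrand x y).intervalIntegrable a b

theorem slitIntegral_recurrence (x : ℤ) :
    (x + 1) * slitIntegral (x + 1) 0 = x * slitIntegral (x - 1) 0 := by
  have h := intervalIntegral.integral_eq_sub_of_hasDerivAt (a := 0) (b := Real.pi)
    (fun s _ => slitKernel_boundary_hasDerivAt x s) (by
      have h1 := (intervalIntegrable_slitIntegrand (x + 1) 0 0 Real.pi).const_mul ((x : ℂ) + 1)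
      have h2 := (intervalIntegrable_slitIntegrand (x - 1) 0 0 Real.pi).const_mul (x : ℂ)
      simpa using h1.sub h2)
  rw [intervalIntegral.integral_sub] at h
  · rw [intervalIntegral.integral_const_mul, intervalIntegral.integral_const_mul] at h
    simp only [slitIntegral, pow_zero, one_mul]
    simp only [Real.sin_pi, Real.sin_zero, Complex.ofReal_zero, zero_mul, sub_zero] at h
    exact sub_eq_zero.mp h
  · simpa using (intervalIntegrable_slitIntegrand (x + 1) 0 0 Real.pi).const_mul ((x : ℂ) + 1)
  · simpa using (intervalIntegrable_slitIntegrand (x - 1) 0 0 Real.pi).const_mul (x : ℂ)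

theorem slitIntegral_harmonic (x : ℤ) (y : ℕ) :
    4 * slitIntegral x (y + 1) = slitIntegral (x - 1) y + slitIntegral (x + 1) y +
      slitIntegral (x - 1) (y + 2) + slitIntegral (x + 1) (y + 2) := by
  have i := fun x y => intervalIntegrable_slitIntegrand x y 0 Real.pi
  simp only [slitIntegral]
  rw [← intervalIntegral.integral_add (i _ _) (i _ _),
    ← intervalIntegral.integral_add ((i _ _).add (i _ _)) (i _ _),
    ← intervalIntegral.integral_add (((i _ _).add (i _ _)).add (i _ _)) (i _ _),
    ← intervalIntegral.integral_const_mul]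
  congr 1
  ext τ
  linear_combination (-(Real.cos τ : ℂ) ^ y) * slitKernel_add_neighbors x (Real.cos τ)

theorem slitIntegral_current (x : ℤ) :
    slitIntegral (x + 1) 0 - slitIntegral (x - 1) 0 =
      Complex.I * (2 * slitIntegral x 0 - (slitIntegral (x + 1) 1 + slitIntegral (x - 1) 1)) := by
  have i := fun x y => intervalIntegrable_slitIntegrand x y 0 Real.pi
  simp only [slitIntegral]
  rw [← intervalIntegral.integral_add (i _ _) (i _ _),
    ← intervalIntegral.integral_const_mul,
    ← intervalIntegral.integral_sub ((i _ _).const_mul _) ((i _ _).add (i _ _)),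
    ← intervalIntegral.integral_sub (i _ _) (i _ _),
    ← intervalIntegral.integral_const_mul]
  congr 1
  ext τ
  linear_combination slitKernel_sub_neighbors x (Real.cos τ)

theorem slitIntegral_odd (k : ℕ) : slitIntegral (2 * k + 1) 0 = 0 := by
  induction k with
  | zero => simpa using slitIntegral_recurrence 0
  | succ k ih =>
    have h := slitIntegral_recurrence (2 * k + 2)
    rw [show (2 * k + 2 - 1 : ℤ) = 2 * k + 1 by ring, ih, mul_zero, mul_eq_zero] at h
    rcases h with h | h
    · exfalso
      have h' : ((2 * k + 2 : ℤ) + 1 : ℤ) = 0 := by exact_mod_cast h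
      omega
    · rw [← h]
      push_cast
      ring_nf

theorem slitIntegral_neg_even (k : ℕ) : slitIntegral (-2 * k - 2) 0 = 0 := by
  induction k with
  | zero =>
    have h := slitIntegral_recurrence (-1)
    norm_num at h
    simpa using h
  | succ k ih =>
    have h := slitIntegral_recurrence (-2 * k - 3)
    rw [show (-2 * k - 3 + 1 : ℤ) = -2 * k - 2 by ring, ih, mul_zero, eq_comm, mul_eq_zero] at h
    rcases h with h | h
    · exfalso
      have h' : (-2 * k - 3 : ℤ) = 0 := by exact_mod_cast h
      omega
    · rw [← h]
      push_cast
      ring_nf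

theorem re_slitKernel_zero (t : ℝ) : (slitKernel 0 t).re = 1 / (1 + t ^ 2) := by
  simp [slitKernel, Complex.inv_re, Complex.normSq_apply, sq]

theorem re_slitKernel_neg_one (t : ℝ) : (slitKernel (-1) t).re = t / (1 + t ^ 2) := by
  have h : slitKernel (-1) t = ((t : ℂ) + Complex.I)⁻¹ := by
    rw [slitKernel, zpow_neg_one, slitPhase, inv_div, div_div_cancel_left']
    exact one_add_I_mul_ofReal_ne_zero t
  rw [h, Complex.inv_re]
  simp [Complex.normSq_apply, sq, add_comm]

theorem im_slitKernel_neg_one (t : ℝ) : (slitKernel (-1) t).im = -(1 / (1 + t ^ 2)) := by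
  have h : slitKernel (-1) t = ((t : ℂ) + Complex.I)⁻¹ := by
    rw [slitKernel, zpow_neg_one, slitPhase, inv_div, div_div_cancel_left']
    exact one_add_I_mul_ofReal_ne_zero t
  rw [h, Complex.inv_im]
  simp [Complex.normSq_apply, sq, add_comm, neg_div]

theorem re_slitIntegral (x : ℤ) (y : ℕ) :
    (slitIntegral x y).re =
      ∫ τ in (0 : ℝ)..Real.pi, Real.cos τ ^ y * (slitKernel x (Real.cos τ)).re := by
  have h := Complex.reCLM.intervalIntegral_comp_comm
    (intervalIntegrable_slitIntegrand x y 0 Real.pi)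
  simp only [Complex.reCLM_apply] at h
  rw [slitIntegral, ← h]
  congr 1
  ext τ
  rw [← Complex.ofReal_pow, Complex.re_ofReal_mul]

theorem im_slitIntegral (x : ℤ) (y : ℕ) :
    (slitIntegral x y).im =
      ∫ τ in (0 : ℝ)..Real.pi, Real.cos τ ^ y * (slitKernel x (Real.cos τ)).im := by
  have h := Complex.imCLM.intervalIntegral_comp_comm
    (intervalIntegrable_slitIntegrand x y 0 Real.pi)
  simp only [Complex.imCLM_apply] at h
  rw [slitIntegral, ← h]
  congr 1
  ext τ
  rw [← Complex.ofReal_pow, Complex.im_ofReal_mul]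

theorem integral_one_div_one_add_cos_sq :
    ∫ τ in (0 : ℝ)..Real.pi, 1 / (1 + Real.cos τ ^ 2) = Real.pi / √2 := by
  have hr0 : (0 : ℝ) < √2 := by positivity
  have hr : √2 ^ 2 = 2 := Real.sq_sqrt (by norm_num)
  have hpos : ∀ τ : ℝ, 0 < √2 * Real.cos τ ^ 2 + Real.sin τ ^ 2 := by
    intro τ
    have h1 := Real.sin_sq_add_cos_sq τ
    have h2 : 1 < √2 := by
      rw [Real.lt_sqrt] <;> norm_num
    nlinarith [sq_nonneg (Real.cos τ), sq_nonneg (Real.sin τ)]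
  have hderiv : ∀ τ : ℝ, HasDerivAt
      (fun τ => (τ - Real.arctan ((√2 - 1) * (Real.sin τ * Real.cos τ) /
        (√2 * Real.cos τ ^ 2 + Real.sin τ ^ 2))) / √2)
      (1 / (1 + Real.cos τ ^ 2)) τ := by
    intro τ
    have hs := Real.hasDerivAt_sin τ
    have hc := Real.hasDerivAt_cos τ
    have hn := ((hs.mul hc).const_mul (√2 - 1)).div
      (((hc.pow 2).const_mul (√2)).add (hs.pow 2)) (hpos τ).ne'
    convert! (((hasDerivAt_id τ).sub hn.arctan).div_const (√2)) using 1
    have hp := (hpos τ)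
    have h1 := Real.sin_sq_add_cos_sq τ
    simp only [Pi.add_apply, Pi.mul_apply, Pi.pow_apply, Pi.div_apply]
    generalize Real.cos τ = c at *
    generalize Real.sin τ = s at *
    have hd : (√2 * c ^ 2 + s ^ 2) ^ 2 + ((√2 - 1) * (s * c)) ^ 2 = 1 + c ^ 2 := by
      have h2 : s ^ 2 = 1 - c ^ 2 := by linarith
      rw [mul_pow, mul_pow, h2]
      linear_combination (c ^ 2) * hr
    have hq : 1 + ((√2 - 1) * (s * c) / (√2 * c ^ 2 + s ^ 2)) ^ 2 =
        (1 + c ^ 2) / (√2 * c ^ 2 + s ^ 2) ^ 2 := by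
      rw [← hd]
      field_simp
    rw [hq]
    have h3 : 0 < 1 + c ^ 2 := by positivity
    have hN : (√2 - 1) * (c * c + s * -s) * (√2 * c ^ 2 + s ^ 2) -
        (√2 - 1) * (s * c) * (√2 * (2 * c * -s) + 2 * s * c) = 1 + c ^ 2 - √2 := by
      have h2 : s ^ 2 = 1 - c ^ 2 := by linarith
      linear_combination (c ^ 2) * hr + (-(√2 - 1) * (s ^ 2 + 1 - c ^ 2) +
        (√2 - 1) * (c ^ 2 - √2 * c ^ 2) + 2 * (√2 - 1) ^ 2 * c ^ 2) * h2
    norm_num only [pow_one, Nat.cast_ofNat, Nat.reduceSub]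
    rw [hN]
    generalize √2 * c ^ 2 + s ^ 2 = D at *
    field_simp
    ring
  rw [intervalIntegral.integral_eq_sub_of_hasDerivAt (fun τ _ => hderiv τ)]
  · simp
  · apply Continuous.intervalIntegrable
    exact continuous_const.div (by fun_prop) (fun τ => by positivity)

theorem tendsto_integral_abs_cos_pow :
    Filter.Tendsto (fun n : ℕ => ∫ τ in (0 : ℝ)..Real.pi, |Real.cos τ| ^ n) Filter.atTop
      (nhds 0) := by
  have h := intervalIntegral.tendsto_integral_filter_of_dominated_convergence
    (μ := MeasureTheory.volume) (a := 0) (b := Real.pi) (l := Filter.atTop)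
    (F := fun (n : ℕ) τ => |Real.cos τ| ^ n) (f := fun _ => (0 : ℝ)) (fun _ => 1) ?_ ?_ ?_ ?_
  · simpa using h
  · exact .of_forall fun n => (by fun_prop : Continuous fun τ => |Real.cos τ| ^ n).aestronglyMeasurable
  · refine .of_forall fun n => .of_forall fun τ _ => ?_
    rw [Real.norm_eq_abs, abs_of_nonneg (by positivity)]
    exact pow_le_one₀ (abs_nonneg _) (Real.abs_cos_le_one τ)
  · exact intervalIntegrable_const
  · have hne : ∀ᵐ τ : ℝ, τ ≠ Real.pi := by
      simp [MeasureTheory.ae_iff]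
    filter_upwards [hne] with τ hτ hmem
    rw [Set.uIoc_of_le Real.pi_pos.le] at hmem
    refine tendsto_pow_atTop_nhds_zero_of_lt_one (abs_nonneg _) ?_
    have hsin : 0 < Real.sin τ := Real.sin_pos_of_pos_of_lt_pi hmem.1 (lt_of_le_of_ne hmem.2 hτ)
    rw [← sq_lt_one_iff_abs_lt_one]
    nlinarith [Real.sin_sq_add_cos_sq τ]

theorem norm_slitIntegral_le (x : ℤ) (y : ℕ) :
    ‖slitIntegral x y‖ ≤ ∫ τ in (0 : ℝ)..Real.pi, |Real.cos τ| ^ y := by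
  refine intervalIntegral.norm_integral_le_of_norm_le Real.pi_pos.le (.of_forall fun τ _ => ?_)
    ((by fun_prop : Continuous fun τ => |Real.cos τ| ^ y).intervalIntegrable _ _)
  rw [norm_mul, norm_pow, Complex.norm_real, Real.norm_eq_abs]
  exact mul_le_of_le_one_right (by positivity) (norm_slitKernel_le _ _)

/-- The normalized moments of the arcsine law. -/
noncomputable def cosMoment (n : ℕ) : ℝ := (∫ τ in (0 : ℝ)..Real.pi, Real.cos τ ^ n) / Real.pi

theorem cosMoment_zero : cosMoment 0 = 1 := by
  simp [cosMoment, Real.pi_ne_zero]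

theorem cosMoment_add_two (n : ℕ) : cosMoment (n + 2) = (n + 1) / (n + 2) * cosMoment n := by
  rw [cosMoment, integral_cos_pow, cosMoment]
  simp [mul_div_assoc]

theorem cosMoment_odd {n : ℕ} (hn : Odd n) : cosMoment n = 0 := by
  obtain ⟨k, rfl⟩ := hn
  induction k with
  | zero => simp [cosMoment]
  | succ k ih => rw [show 2 * (k + 1) + 1 = 2 * k + 1 + 2 by ring, cosMoment_add_two, ih, mul_zero]

/-- An integral formula for the slit-plane Green's function at `(x, y)` with `x + y` even. -/
noncomputable def slitValue (x : ℤ) (y : ℕ) : ℝ := √2 / Real.pi * (slitIntegral x y).re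

theorem slitValue_harmonic (x : ℤ) (y : ℕ) :
    4 * slitValue x (y + 1) = slitValue (x - 1) y + slitValue (x + 1) y +
      slitValue (x - 1) (y + 2) + slitValue (x + 1) (y + 2) := by
  have h := congrArg Complex.re (slitIntegral_harmonic x y)
  simp only [Complex.add_re, Complex.mul_re, Complex.re_ofNat, Complex.im_ofNat, zero_mul,
    sub_zero] at h
  simp only [slitValue]
  linear_combination (√2 / Real.pi) * h

theorem slitValue_neg_even (k : ℕ) : slitValue (-2 * k - 2) 0 = 0 := by
  rw [slitValue, slitIntegral_neg_even, Complex.zero_re, mul_zero]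

theorem slitValue_reflect (k : ℕ) :
    2 * slitValue (2 * k + 2) 0 = slitValue (2 * k + 2 - 1) 1 + slitValue (2 * k + 2 + 1) 1 := by
  have h := slitIntegral_current (2 * k + 2)
  have h1 := slitIntegral_odd k
  have h2 := slitIntegral_odd (k + 1)
  rw [show (2 * (k + 1 : ℕ) + 1 : ℤ) = 2 * k + 2 + 1 by push_cast; ring] at h2
  rw [show (2 * k + 1 : ℤ) = 2 * k + 2 - 1 by ring] at h1
  rw [h1, h2, sub_zero, eq_comm, mul_eq_zero, or_iff_right Complex.I_ne_zero] at h
  have h3 := congrArg Complex.re h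
  simp only [Complex.sub_re, Complex.add_re, Complex.mul_re, Complex.re_ofNat, Complex.im_ofNat,
    zero_mul, sub_zero, Complex.zero_re] at h3
  simp only [slitValue]
  linear_combination (√2 / Real.pi) * h3

theorem sqrt_two_div_pi_mul : √2 / Real.pi * (Real.pi / √2) = 1 := by
  have := Real.pi_ne_zero
  field_simp

theorem slitValue_origin : 2 * slitValue 0 0 - slitValue 1 1 - slitValue (-1) 1 = 1 := by
  have h := congrArg Complex.im (slitIntegral_current 0)
  have h1 := slitIntegral_odd 0
  norm_num at h h1
  have h2 : (slitIntegral (-1) 0).im = -(Real.pi / √2) := by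
    rw [im_slitIntegral, ← integral_one_div_one_add_cos_sq, ← intervalIntegral.integral_neg]
    simp [im_slitKernel_neg_one]
  rw [h1, h2] at h
  simp only [Complex.zero_im] at h
  simp only [slitValue]
  linear_combination (-(√2 / Real.pi)) * h + sqrt_two_div_pi_mul

theorem slitValue_zero_zero : slitValue 0 0 = 1 := by
  rw [slitValue, re_slitIntegral, ← sqrt_two_div_pi_mul, ← integral_one_div_one_add_cos_sq]
  simp [re_slitKernel_zero]

theorem slitValue_even (k : ℕ) : slitValue (2 * k) 0 = cosMoment (2 * k) := by
  induction k with
  | zero => simp [slitValue_zero_zero, cosMoment_zero]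
  | succ k ih =>
    have h := slitIntegral_recurrence (2 * k + 1)
    rw [show (2 * k + 1 - 1 : ℤ) = 2 * k by ring] at h
    have h1 := congrArg Complex.re h
    have e1 : (((2 * k + 1 : ℤ) : ℂ) + 1) = ((2 * k + 2 : ℝ) : ℂ) := by push_cast; ring
    have e2 : ((2 * k + 1 : ℤ) : ℂ) = ((2 * k + 1 : ℝ) : ℂ) := by push_cast; ring
    rw [e1, e2, Complex.re_ofReal_mul, Complex.re_ofReal_mul] at h1
    rw [show 2 * (k + 1) = 2 * k + 2 by ring, cosMoment_add_two, ← ih,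
      show (2 * (k + 1 : ℕ) : ℤ) = 2 * k + 1 + 1 by push_cast; ring]
    simp only [slitValue]
    push_cast
    field_simp
    linear_combination h1

theorem slitValue_zero_add (y : ℕ) :
    slitValue 0 y + slitValue 0 (y + 2) = √2 * cosMoment y := by
  have i : ∀ y : ℕ, IntervalIntegrable (fun τ => Real.cos τ ^ y * (1 / (1 + Real.cos τ ^ 2)))
      MeasureTheory.volume 0 Real.pi := fun y =>
    (((by fun_prop : Continuous fun τ => Real.cos τ ^ y)).mul
      (continuous_const.div (by fun_prop) (fun τ => by positivity))).intervalIntegrable _ _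
  rw [slitValue, slitValue, cosMoment, re_slitIntegral, re_slitIntegral, ← mul_add]
  simp only [re_slitKernel_zero]
  rw [← intervalIntegral.integral_add (i _) (i _), div_mul_eq_mul_div, mul_div_assoc]
  congr 3
  ext τ
  field_simp
  ring

theorem slitValue_neg_one (y : ℕ) : slitValue (-1) y = slitValue 0 (y + 1) := by
  rw [slitValue, slitValue, re_slitIntegral, re_slitIntegral]
  congr 2
  ext τ
  rw [re_slitKernel_neg_one, re_slitKernel_zero]
  ring

theorem abs_slitValue_le (x : ℤ) (y : ℕ) :
    |slitValue x y| ≤ √2 / Real.pi * ∫ τ in (0 : ℝ)..Real.pi, |Real.cos τ| ^ y := by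
  have hc : 0 ≤ √2 / Real.pi := by positivity
  rw [slitValue, abs_mul, abs_of_nonneg hc]
  exact mul_le_mul_of_nonneg_left
    ((Complex.abs_re_le_norm _).trans (norm_slitIntegral_le x y)) hc

theorem abs_slitValue_le_sqrt_two (x : ℤ) (y : ℕ) : |slitValue x y| ≤ √2 := by
  refine (abs_slitValue_le x y).trans ?_
  have h : ∫ τ in (0 : ℝ)..Real.pi, |Real.cos τ| ^ y ≤ ∫ _ in (0 : ℝ)..Real.pi, (1 : ℝ) :=
    intervalIntegral.integral_mono_on Real.pi_pos.le
      ((by fun_prop : Continuous fun τ => |Real.cos τ| ^ y).intervalIntegrable _ _)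
      intervalIntegrable_const
      (fun τ _ => pow_le_one₀ (abs_nonneg _) (Real.abs_cos_le_one τ))
  rw [intervalIntegral.integral_const, sub_zero, smul_eq_mul, mul_one] at h
  calc _ ≤ √2 / Real.pi * Real.pi := mul_le_mul_of_nonneg_left h (by positivity)
    _ = √2 := div_mul_cancel₀ _ Real.pi_ne_zero

theorem slitValue_eventually_small {ε : ℝ} (hε : 0 < ε) :
    ∃ N : ℕ, ∀ (x : ℤ) (y : ℕ), N ≤ y → |slitValue x y| < ε := by
  have h := tendsto_integral_abs_cos_pow.const_mul (√2 / Real.pi)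
  rw [mul_zero] at h
  obtain ⟨N, hN⟩ := Filter.eventually_atTop.mp (h.eventually_lt_const hε)
  exact ⟨N, fun x y hy => (abs_slitValue_le x y).trans_lt (hN y hy)⟩

/-- A maximum principle on the even sublattice of the half-plane, with Dirichlet boundary values on
the negative axis and a reflecting boundary on the rest of the axis. -/
theorem slit_maximum_principle (f : ℤ → ℕ → ℝ) (B : ℝ)
    (hB : ∀ (x : ℤ) (y : ℕ), Even (x + (y : ℤ)) → f x y ≤ B)
    (hneg : ∀ x : ℤ, x < 0 → Even x → f x 0 ≤ 0)
    (hrefl : ∀ x : ℤ, 0 ≤ x → Even x → 2 * f x 0 = f (x - 1) 1 + f (x + 1) 1)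
    (hharm : ∀ (x : ℤ) (y : ℕ), Even (x + ((y + 1 : ℕ) : ℤ)) →
      4 * f x (y + 1) = f (x - 1) y + f (x + 1) y + f (x - 1) (y + 2) + f (x + 1) (y + 2))
    (hdecay : ∀ ε : ℝ, 0 < ε → ∃ N : ℕ, ∀ (x : ℤ) (y : ℕ), N ≤ y → Even (x + (y : ℤ)) → f x y < ε)
    (x : ℤ) (y : ℕ) (hxy : Even (x + (y : ℤ))) : f x y ≤ 0 := by
  let S : Set ℝ := {v | ∃ (x : ℤ) (y : ℕ), Even (x + (y : ℤ)) ∧ f x y = v}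
  have hbdd : BddAbove S := ⟨B, by rintro _ ⟨x, y, h, rfl⟩; exact hB x y h⟩
  have hle : ∀ (x : ℤ) (y : ℕ), Even (x + (y : ℤ)) → f x y ≤ sSup S :=
    fun x y h => le_csSup hbdd ⟨x, y, h, rfl⟩
  by_contra! hpos
  have hM : 0 < sSup S := hpos.trans_le (hle x y hxy)
  obtain ⟨N, hN⟩ := hdecay (sSup S / 2) (by positivity)
  have hstep : ∀ (ε : ℝ) (x : ℤ) (y : ℕ), ε ≤ sSup S → Even (x + (y : ℤ)) →
      sSup S - ε < f x y → sSup S - 4 * ε < f (x - 1) (y + 1) := by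
    intro ε x y hε hxy hlt
    cases y with
    | zero =>
      have hx : Even x := by simpa using hxy
      have hx0 : 0 ≤ x := by
        by_contra! h
        linarith [hneg x h hx]
      have h1 := hrefl x hx0 hx
      have h2 := hle (x + 1) 1 (by simpa [add_assoc] using hx.add even_two)
      have h3 := hle x 0 hxy
      linarith
    | succ y =>
      have h1 := hharm x y hxy
      have h2 := hle (x - 1) y (by rw [Int.even_iff] at hxy ⊢; omega)
      have h3 := hle (x + 1) y (by rw [Int.even_iff] at hxy ⊢; omega)
      have h4 := hle (x + 1) (y + 2) (by rw [Int.even_iff] at hxy ⊢; omega)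
      linarith
  have hiter : ∀ (n : ℕ) (x : ℤ) (y : ℕ), Even (x + (y : ℤ)) →
      sSup S - sSup S / 2 / 4 ^ N < f x y → n ≤ N →
      sSup S - 4 ^ n * (sSup S / 2 / 4 ^ N) < f (x - n) (y + n) := by
    intro n x y hxy hlt
    induction n with
    | zero => intro _; simpa using hlt
    | succ n ih =>
      intro hn
      have h := hstep (4 ^ n * (sSup S / 2 / 4 ^ N)) (x - n) (y + n) ?_ ?_ (ih (by omega))
      · convert h using 2 <;> push_cast <;> ring
      · have h4 : (4 : ℝ) ^ n ≤ 4 ^ N := pow_le_pow_right₀ (by norm_num) (by omega)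
        calc 4 ^ n * (sSup S / 2 / 4 ^ N) ≤ 4 ^ N * (sSup S / 2 / 4 ^ N) := by gcongr
          _ = sSup S / 2 := by field_simp
          _ ≤ sSup S := by linarith
      · convert hxy using 1; push_cast; ring
  obtain ⟨_, ⟨x', y', hxy', rfl⟩, hlt⟩ :=
    exists_lt_of_lt_csSup (s := S) ⟨_, x, y, hxy, rfl⟩
      (show sSup S - sSup S / 2 / 4 ^ N < sSup S by
        have : 0 < sSup S / 2 / 4 ^ N := by positivity
        linarith)
  have h1 := hiter N x' y' hxy' hlt le_rfl
  have h2 := hN (x' - N) (y' + N) (by omega) (by convert hxy' using 1; push_cast; ring)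
  have h3 : 4 ^ N * (sSup S / 2 / 4 ^ N) = sSup S / 2 := by field_simp
  linarith

namespace IsSlitGreen

variable {g : ℤ × ℤ → ℝ}

theorem eq_slitValue (hg : IsSlitGreen g) (x : ℤ) (y : ℕ) (hxy : Even (x + (y : ℤ))) :
    g (x, (y : ℤ)) = slitValue x y := by
  obtain ⟨-, hneg, hharm, hrefl, horigin, hbound, hdecay⟩ := hg
  have key : ∀ σ : ℝ, |σ| = 1 → σ * (g (x, (y : ℤ)) - slitValue x y) ≤ 0 := by
    intro σ hσ
    have habs : ∀ (x : ℤ) (y : ℕ), σ * (g (x, (y : ℤ)) - slitValue x y) ≤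
        |g (x, (y : ℤ))| + |slitValue x y| := by
      intro x y
      calc _ ≤ |σ * (g (x, (y : ℤ)) - slitValue x y)| := le_abs_self _
        _ = |g (x, (y : ℤ)) - slitValue x y| := by rw [abs_mul, hσ, one_mul]
        _ ≤ _ := abs_sub _ _
    refine slit_maximum_principle (fun x y => σ * (g (x, (y : ℤ)) - slitValue x y)) (1 + √2)
      ?_ ?_ ?_ ?_ ?_ x y hxy
    · intro x y _
      refine (habs x y).trans (add_le_add ?_ (abs_slitValue_le_sqrt_two x y))
      exact abs_le.mpr ⟨by linarith [(hbound x y).1], (hbound x y).2⟩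
    · intro x hx hev
      obtain ⟨k, rfl⟩ : ∃ k : ℕ, x = -2 * k - 2 := by
        obtain ⟨m, rfl⟩ := hev
        exact ⟨(-m - 1).toNat, by omega⟩
      rw [slitValue_neg_even, Nat.cast_zero, hneg _ hx]
      simp
    · intro x hx hev
      rcases hx.eq_or_lt with rfl | hx
      · have h := slitValue_origin
        simp only [zero_sub, zero_add, Nat.cast_zero, Nat.cast_one]
        linear_combination σ * (horigin - h)
      · have h1 := hrefl x hx hev
        obtain ⟨k, rfl⟩ : ∃ k : ℕ, x = 2 * k + 2 := by
          obtain ⟨m, rfl⟩ := hev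
          exact ⟨(m - 1).toNat, by omega⟩
        have h2 := slitValue_reflect k
        simp only [Nat.cast_zero, Nat.cast_one]
        linear_combination σ * (h1 - h2)
    · intro x y hev
      have h1 := hharm x ((y + 1 : ℕ) : ℤ) (by omega) hev
      have h2 := slitValue_harmonic x y
      rw [show ((y + 1 : ℕ) : ℤ) - 1 = (y : ℤ) by push_cast; ring,
        show ((y + 1 : ℕ) : ℤ) + 1 = ((y + 2 : ℕ) : ℤ) by push_cast; ring] at h1
      linear_combination σ * (h1 - h2)
    · intro ε hε
      obtain ⟨N, hN⟩ := hdecay (ε / 2) (by positivity)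
      obtain ⟨N', hN'⟩ := slitValue_eventually_small (half_pos hε)
      refine ⟨max N N', fun x y hy _ => ?_⟩
      have h1 := hN x y (by
        have := abs_nonneg x
        rw [Nat.abs_cast]
        omega)
      have h2 := hN' x y (by omega)
      linarith [habs x y]
  have h1 := key 1 (by simp)
  have h2 := key (-1) (by simp)
  linarith

theorem nonneg_axis_eq (hg : IsSlitGreen g) (n : ℕ) : g ((n : ℤ), 0) = cosMoment n := by
  rcases Nat.even_or_odd n with hn | hn
  · have h := hg.eq_slitValue n 0 (by simpa using hn)
    obtain ⟨k, rfl⟩ := hn.two_dvd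
    rw [Nat.cast_zero] at h
    rw [h, ← slitValue_even k]
    push_cast
    rfl
  · rw [cosMoment_odd hn]
    exact hg.1 _ _ (Or.inr (by simpa using hn))

theorem zero_add_eq (hg : IsSlitGreen g) (n : ℕ) :
    g (0, (n : ℤ)) + g (0, (n : ℤ) + 2) = √2 * cosMoment n := by
  rcases Nat.even_or_odd n with hn | hn
  · have hn' : Even (n : ℤ) := by exact_mod_cast hn
    have h1 := hg.eq_slitValue 0 n (by simpa using hn')
    have h2 := hg.eq_slitValue 0 (n + 2) (by
      rw [Int.even_iff] at hn' ⊢; omega)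
    push_cast at h2
    rw [h1, h2, slitValue_zero_add]
  · have hn' : Odd (n : ℤ) := by exact_mod_cast hn
    rw [cosMoment_odd hn, hg.1 _ _ (Or.inr (by simpa using hn')),
      hg.1 _ _ (Or.inr (by rw [Int.odd_iff] at hn' ⊢; omega))]
    simp

theorem neg_one_add_eq (hg : IsSlitGreen g) (n : ℕ) :
    g (-1, (n : ℤ)) + g (-1, (n : ℤ) + 2) = √2 * cosMoment (n + 1) := by
  rcases Nat.even_or_odd n with hn | hn
  · have hn' : Even (n : ℤ) := by exact_mod_cast hn
    rw [cosMoment_odd hn.add_one,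
      hg.1 _ _ (Or.inr (by rw [Int.even_iff] at hn'; rw [Int.odd_iff]; omega)),
      hg.1 _ _ (Or.inr (by rw [Int.even_iff] at hn'; rw [Int.odd_iff]; omega))]
    simp
  · have hn' : Odd (n : ℤ) := by exact_mod_cast hn
    have h1 := hg.eq_slitValue (-1) n (by rw [Int.odd_iff] at hn'; rw [Int.even_iff]; omega)
    have h2 := hg.eq_slitValue (-1) (n + 2) (by rw [Int.odd_iff] at hn'; rw [Int.even_iff]; omega)
    push_cast at h2
    rw [h1, h2, slitValue_neg_one, slitValue_neg_one, slitValue_zero_add (n + 1)]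

theorem neg_one_one_eq (hg : IsSlitGreen g) : g (-1, 1) = √2 - 1 := by
  have h1 := hg.eq_slitValue (-1) 1 (by simp)
  have h2 := slitValue_zero_add 0
  rw [slitValue_zero_zero, cosMoment_zero] at h2
  rw [Nat.cast_one] at h1
  rw [h1, slitValue_neg_one]
  linarith

end IsSlitGreen

theorem hasSum_cosMoment {z : ℝ} (hz0 : 0 < z) (hz1 : z < 1) :
    HasSum (fun n : ℕ => cosMoment n * z ^ n) (1 / √(1 - z ^ 2)) := by
  have hcoeff : ∀ n : ℕ, cosMoment (2 * n) = Ring.choose ((1 / 2 : ℝ) + n - 1) n := by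
    intro n
    have hpoch : (n.factorial : ℝ) * cosMoment (2 * n) =
        Polynomial.eval (1 / 2 : ℝ) (ascPochhammer ℝ n) := by
      induction n with
      | zero => simp [cosMoment_zero]
      | succ n ih =>
        rw [ascPochhammer_succ_eval, ← ih, show 2 * (n + 1) = 2 * n + 2 by ring,
          cosMoment_add_two, Nat.factorial_succ]
        push_cast
        field_simp
        ring
    have h := Ring.factorial_nsmul_multichoose_eq_ascPochhammer (1 / 2 : ℝ) n
    rw [Polynomial.ascPochhammer_smeval_eq_eval, ← hpoch, nsmul_eq_mul] at h
    rw [Ring.choose, show (1 / 2 + n - 1 - n + 1 : ℝ) = 1 / 2 by ring]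
    exact (mul_left_cancel₀ (by positivity) h).symm
  have hinj : Function.Injective fun n : ℕ => 2 * n := fun a b h => by simpa using h
  rw [← hinj.hasSum_iff]
  · have h := Real.one_div_one_sub_rpow_hasFPowerSeriesOnBall_zero (1 / 2)
    have h1 := h.hasSum (y := z ^ 2) (by
      have hz2 : z ^ 2 < 1 := by nlinarith
      rw [← ENNReal.ofReal_one, Metric.eball_ofReal, mem_ball_zero_iff, Real.norm_eq_abs,
        abs_of_nonneg (by positivity)]
      exact hz2)
    rw [Real.sqrt_eq_rpow]
    convert! h1 using 1
    · ext n
      rw [Function.comp_apply, hcoeff]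
      simp [← pow_mul, mul_comm]
    · simp
  · intro n hn
    have : Odd n := by
      by_contra h
      obtain ⟨k, rfl⟩ := (Nat.not_odd_iff_even.mp h).two_dvd
      exact hn ⟨k, rfl⟩
    simp [cosMoment_odd this]

theorem HasSum.zpow_shift {F : ℤ × ℤ → ℝ} {z w S : ℝ} (hz : z ≠ 0) (hw : w ≠ 0)
    (h : HasSum (fun p : ℤ × ℤ => F p * (z ^ p.1 * w ^ p.2)) S) (i j : ℤ) :
    HasSum (fun p : ℤ × ℤ => F (p.1 - i, p.2 - j) * (z ^ p.1 * w ^ p.2))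
      (z ^ i * w ^ j * S) := by
  rw [← (Equiv.subRight ((i, j) : ℤ × ℤ)).hasSum_iff] at h
  convert! h.mul_left (z ^ i * w ^ j) using 1
  ext p
  simp only [Function.comp_apply, Equiv.subRight_apply, Prod.fst_sub, Prod.snd_sub]
  rw [zpow_sub₀ hz, zpow_sub₀ hw]
  field_simp
  rfl

/-- The moment sequence `cosMoment` extended by zero to the negative integers. -/
noncomputable def cosMomentInt (n : ℤ) : ℝ := if 0 ≤ n then cosMoment n.toNat else 0

theorem cosMomentInt_natCast (n : ℕ) : cosMomentInt n = cosMoment n := by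
  simp [cosMomentInt]

theorem cosMomentInt_of_neg {n : ℤ} (hn : n < 0) : cosMomentInt n = 0 := by
  simp [cosMomentInt, hn]

theorem hasSum_cosMomentInt_fst {z w : ℝ} (hz0 : 0 < z) (hz1 : z < 1) :
    HasSum (fun p : ℤ × ℤ => (if p.2 = 0 then cosMomentInt p.1 else 0) * (z ^ p.1 * w ^ p.2))
      (1 / √(1 - z ^ 2)) := by
  have hinj : Function.Injective fun n : ℕ => ((n : ℤ), (0 : ℤ)) := fun a b h => by simpa using h
  rw [← hinj.hasSum_iff]
  · convert! hasSum_cosMoment hz0 hz1 using 1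
    ext n
    simp [cosMomentInt_natCast]
  · rintro ⟨x, y⟩ hn
    by_cases hy : y = 0
    · have hx : x < 0 := by
        by_contra! hx
        exact hn ⟨x.toNat, by simp [hx, hy]⟩
      simp [cosMomentInt_of_neg hx]
    · simp [hy]

theorem hasSum_cosMomentInt_snd {z w : ℝ} (hw0 : 0 < w) (hw1 : w < 1) :
    HasSum (fun p : ℤ × ℤ => (if p.1 = 0 then cosMomentInt p.2 else 0) * (z ^ p.1 * w ^ p.2))
      (1 / √(1 - w ^ 2)) := by
  rw [← (Equiv.prodComm ℤ ℤ).hasSum_iff]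
  convert! hasSum_cosMomentInt_fst (w := z) hw0 hw1 using 1
  ext p
  simp [mul_comm]

/-- The restriction of `g` to the closed first quadrant, extended by zero. -/
noncomputable def quadrantPart (g : ℤ × ℤ → ℝ) (p : ℤ × ℤ) : ℝ :=
  if 0 ≤ p.1 ∧ 0 ≤ p.2 then g p else 0

theorem quadrantPart_of_neg (g : ℤ × ℤ → ℝ) {x y : ℤ} (h : x < 0 ∨ y < 0) :
    quadrantPart g (x, y) = 0 := by
  rw [quadrantPart, if_neg]
  rintro ⟨hx, hy⟩
  simp only at hx hy
  omega

namespace IsSlitGreen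

variable {g : ℤ × ℤ → ℝ}

theorem quadrantPart_recurrence (hg : IsSlitGreen g) (x y : ℤ) :
    4 * quadrantPart g (x - 1, y - 1) - quadrantPart g (x - 0, y - 2) -
        quadrantPart g (x - 2, y - 0) - quadrantPart g (x - 2, y - 2) - quadrantPart g (x, y) =
      √2 * ((if x - 1 = 0 then cosMomentInt (y - 1) else 0) -
        (if x - 0 = 0 then cosMomentInt (y - 2) else 0)) +
      (2 * (if y - 1 = 0 then cosMomentInt (x - 1) else 0) -
        (if y - 0 = 0 then cosMomentInt (x - 2) else 0) -
        (if y = 0 then cosMomentInt x else 0)) := by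
  have hodd : ∀ x y : ℤ, Odd (x + y) → g (x, y) = 0 := fun x y h => hg.1 x y (Or.inr h)
  have haxis : ∀ n : ℤ, 0 ≤ n → g (n, 0) = cosMomentInt n := by
    intro n hn
    lift n to ℕ using hn
    rw [hg.nonneg_axis_eq, cosMomentInt_natCast]
  have hcol : ∀ n : ℤ, 0 ≤ n → g (0, n) + g (0, n + 2) = √2 * cosMomentInt n := by
    intro n hn
    lift n to ℕ using hn
    rw [hg.zero_add_eq, cosMomentInt_natCast]
  have hcol' : ∀ n : ℤ, 0 ≤ n → g (-1, n) + g (-1, n + 2) = √2 * cosMomentInt (n + 1) := by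
    intro n hn
    lift n to ℕ using hn
    rw [hg.neg_one_add_eq, ← cosMomentInt_natCast, Nat.cast_add_one]
  have h11 := hg.neg_one_one_eq
  have hzero : cosMomentInt 0 = 1 := by
    rw [← Nat.cast_zero, cosMomentInt_natCast, cosMoment_zero]
  have hone : cosMomentInt 1 = 0 := by
    rw [← haxis 1 (by norm_num), hodd _ _ (by decide)]
  obtain ⟨-, -, hharm, hrefl, horigin, -, -⟩ := hg
  have hharm' : ∀ x y : ℤ, 1 ≤ y → 4 * g (x, y) =
      g (x - 1, y - 1) + g (x + 1, y - 1) + g (x - 1, y + 1) + g (x + 1, y + 1) := by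
    intro x y hy
    rcases Int.even_or_odd (x + y) with h | h
    · exact hharm x y hy h
    · rw [Int.odd_iff] at h
      rw [hodd x y, hodd (x - 1), hodd (x + 1), hodd (x - 1), hodd (x + 1)]
      · ring
      all_goals rw [Int.odd_iff]; omega
  have hrefl' : ∀ x : ℤ, 0 < x → 2 * g (x, 0) = g (x - 1, 1) + g (x + 1, 1) := by
    intro x hx
    rcases Int.even_or_odd x with h | h
    · exact hrefl x hx h
    · rw [Int.odd_iff] at h
      rw [hodd x, hodd (x - 1), hodd (x + 1)]
      · ring
      all_goals rw [Int.odd_iff]; omega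
  simp only [sub_zero]
  rcases lt_or_ge x 0 with hx | hx
  · rw [quadrantPart_of_neg g (by omega), quadrantPart_of_neg g (by omega),
      quadrantPart_of_neg g (by omega), quadrantPart_of_neg g (by omega),
      quadrantPart_of_neg g (by omega), if_neg (by omega), if_neg (by omega),
      cosMomentInt_of_neg hx, cosMomentInt_of_neg (by omega : x - 1 < 0),
      cosMomentInt_of_neg (by omega : x - 2 < 0)]
    simp
  rcases lt_or_ge y 0 with hy | hy
  · rw [quadrantPart_of_neg g (by omega), quadrantPart_of_neg g (by omega),
      quadrantPart_of_neg g (by omega), quadrantPart_of_neg g (by omega),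
      quadrantPart_of_neg g (by omega), if_neg (by omega : ¬ y - 1 = 0),
      if_neg (by omega : ¬ y = 0), if_neg (by omega : ¬ y = 0),
      cosMomentInt_of_neg (by omega : y - 1 < 0), cosMomentInt_of_neg (by omega : y - 2 < 0)]
    simp
  obtain rfl | rfl | hx2 : x = 0 ∨ x = 1 ∨ 2 ≤ x := by omega
  all_goals obtain rfl | rfl | hy2 : y = 0 ∨ y = 1 ∨ 2 ≤ y := by omega
  · simp [quadrantPart, haxis, cosMomentInt_of_neg]
  · simp [quadrantPart, hodd, cosMomentInt_of_neg]
  · have h := hcol (y - 2) (by omega)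
    rw [sub_add_cancel] at h
    simp [quadrantPart, hy, hy2, show y ≠ 0 by omega, show y - 1 ≠ 0 by omega]
    linarith
  · simp [quadrantPart, hodd, hone, cosMomentInt_of_neg]
  · simp [quadrantPart, hzero, haxis] at horigin ⊢
    linarith
  · have h := hcol' (y - 2) (by omega)
    have h' := hharm' 0 (y - 1) (by omega)
    ring_nf at h h'
    simp [quadrantPart, hy, hy2, show y ≠ 0 by omega, show y - 1 ≠ 0 by omega,
      show 1 ≤ y by omega]
    ring_nf
    linarith
  · have h1 := haxis x hx
    have h2 := haxis (x - 2) (by omega)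
    simp [quadrantPart, hx, hx2, show x ≠ 0 by omega, show x - 1 ≠ 0 by omega, h1, h2]
  · have h1 := haxis (x - 1) (by omega)
    have h2 := hrefl' (x - 1) (by omega)
    ring_nf at h1 h2
    simp [quadrantPart, hx, hx2, show x ≠ 0 by omega, show x - 1 ≠ 0 by omega,
      show 1 ≤ x by omega]
    ring_nf
    linarith
  · have h := hharm' (x - 1) (y - 1) (by omega)
    ring_nf at h
    simp [quadrantPart, hx, hx2, hy, hy2, show x ≠ 0 by omega, show x - 1 ≠ 0 by omega,
      show y ≠ 0 by omega, show y - 1 ≠ 0 by omega, show 1 ≤ x by omega, show 1 ≤ y by omega]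
    ring_nf
    linarith

theorem summable_quadrant (hg : IsSlitGreen g) {z w : ℝ} (hz0 : 0 < z) (hz1 : z < 1)
    (hw0 : 0 < w) (hw1 : w < 1) :
    Summable fun p : ℕ × ℕ => g ((p.1 : ℤ), (p.2 : ℤ)) * z ^ p.1 * w ^ p.2 := by
  have hgeom : Summable fun p : ℕ × ℕ => z ^ p.1 * w ^ p.2 :=
    (summable_geometric_of_lt_one hz0.le hz1).mul_of_nonneg
      (summable_geometric_of_lt_one hw0.le hw1) (fun n => by positivity) (fun n => by positivity)
  refine hgeom.of_nonneg_of_le (fun p => ?_) (fun p => ?_)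
  · have := (hg.2.2.2.2.2.1 p.1 p.2).1
    positivity
  · rw [mul_assoc]
    exact mul_le_of_le_one_left (by positivity) (hg.2.2.2.2.2.1 p.1 p.2).2

theorem hasSum_quadrantPart {z w S : ℝ}
    (h : HasSum (fun p : ℕ × ℕ => g ((p.1 : ℤ), (p.2 : ℤ)) * z ^ p.1 * w ^ p.2) S) :
    HasSum (fun p : ℤ × ℤ => quadrantPart g p * (z ^ p.1 * w ^ p.2)) S := by
  have hinj : Function.Injective fun p : ℕ × ℕ => ((p.1 : ℤ), (p.2 : ℤ)) := by
    rintro ⟨a, b⟩ ⟨c, d⟩ h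
    simpa using h
  rw [← hinj.hasSum_iff]
  · convert! h using 1
    ext p
    simp [quadrantPart, mul_assoc]
  · rintro ⟨x, y⟩ hn
    rw [quadrantPart_of_neg, zero_mul]
    by_contra! hxy
    exact hn ⟨(x.toNat, y.toNat), by simp [hxy.1, hxy.2]⟩

theorem quadrant_functional_equation (hg : IsSlitGreen g) {z w S : ℝ} (hz0 : 0 < z) (hz1 : z < 1)
    (hw0 : 0 < w) (hw1 : w < 1)
    (hS : HasSum (fun p : ℕ × ℕ => g ((p.1 : ℤ), (p.2 : ℤ)) * z ^ p.1 * w ^ p.2) S) :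
    (4 * (z * w) - w ^ 2 - z ^ 2 - z ^ 2 * w ^ 2 - 1) * S =
      √2 * (z * w - w ^ 2) * (1 / √(1 - w ^ 2)) +
        (2 * (z * w) - z ^ 2 - 1) * (1 / √(1 - z ^ 2)) := by
  have hF := hasSum_quadrantPart hS
  have hA := hasSum_cosMomentInt_fst (w := w) hz0 hz1
  have hB := hasSum_cosMomentInt_snd (z := z) hw0 hw1
  have sF := hF.zpow_shift hz0.ne' hw0.ne'
  have sA := hA.zpow_shift hz0.ne' hw0.ne'
  have sB := hB.zpow_shift hz0.ne' hw0.ne'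
  have hL := (((((sF 1 1).mul_left 4).sub (sF 0 2)).sub (sF 2 0)).sub (sF 2 2)).sub hF
  have hR := (((sB 1 1).sub (sB 0 2)).mul_left (√2)).add
    ((((sA 1 1).mul_left 2).sub (sA 2 0)).sub hA)
  have h := hL.unique (by
    convert! hR using 1
    ext ⟨x, y⟩
    linear_combination (z ^ x * w ^ y) * hg.quadrantPart_recurrence x y)
  simp only [zpow_one, zpow_zero, one_mul, mul_one] at h
  have z2 : z ^ (2 : ℤ) = z ^ 2 := zpow_ofNat z 2
  have w2 : w ^ (2 : ℤ) = w ^ 2 := zpow_ofNat w 2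
  rw [z2, w2] at h
  linear_combination h

end IsSlitGreen

/-- First-quadrant generating function of the slit-plane Green's function. -/
theorem slitGreen_quadrant_gf_NE (g : ℤ × ℤ → ℝ) (hg : IsSlitGreen g) :
    ∀ z w : ℝ, 0 < z → z < 1 → 0 < w → w < 1 →
      (4 - w / z - z / w - z * w - 1 / (z * w) ≠ 0) ∧
      HasSum (fun p : ℕ × ℕ => g ((p.1 : ℤ), (p.2 : ℤ)) * z ^ p.1 * w ^ p.2)
        ((Real.sqrt 2 * (1 - w / z) / Real.sqrt (1 - w ^ 2) +
            (2 - z / w - 1 / (z * w)) / Real.sqrt (1 - z ^ 2)) /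
          (4 - w / z - z / w - z * w - 1 / (z * w))) := by
  intro z w hz0 hz1 hw0 hw1
  have hK : 4 - w / z - z / w - z * w - 1 / (z * w) =
      (4 * (z * w) - w ^ 2 - z ^ 2 - z ^ 2 * w ^ 2 - 1) / (z * w) := by
    field_simp
  have hneg : 4 * (z * w) - w ^ 2 - z ^ 2 - z ^ 2 * w ^ 2 - 1 < 0 := by
    nlinarith [sq_nonneg (z - w),
      sq_pos_of_pos (sub_pos.mpr (mul_lt_one_of_nonneg_of_lt_one_left hz0.le hz1 hw1.le))]
  have hne : 4 - w / z - z / w - z * w - 1 / (z * w) ≠ 0 := by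
    rw [hK]
    exact div_ne_zero hneg.ne (by positivity)
  refine ⟨hne, ?_⟩
  obtain ⟨S, hS⟩ := hg.summable_quadrant hz0 hz1 hw0 hw1
  have h := hg.quadrant_functional_equation hz0 hz1 hw0 hw1 hS
  convert hS using 1
  rw [div_eq_iff hne, hK, mul_div_assoc', mul_comm S, h]
  have h1 : 0 < √(1 - w ^ 2) := Real.sqrt_pos.mpr (by nlinarith)
  have h2 : 0 < √(1 - z ^ 2) := Real.sqrt_pos.mpr (by nlinarith)
  field_simp
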